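/- For Lebesgue-almost every irrational α ∈ (0,1) there exists a constant C₁ > 0 such that for all n ≥ 2, Σ_{i=1}^{n} a_i(α) < C₁·n·(log n)^3. -/

import Mathlib

open MeasureTheory Filter Set

noncomputable def gaussMap (x : ℝ) : ℝ := Int.fract (1 / x)

/-- The `n`-th continued fraction partial quotient of `α` (for `n ≥ 1`). -/
noncomputable def cfA (α : ℝ) (n : ℕ) : ℕ := ⌊1 / (gaussMap^[n - 1] α)⌋₊

/-- Density of the (unnormalised) Gauss measure. -/
noncomputable def rhoG (x : ℝ) : ENNReal := ENNReal.ofReal (1 / (1 + x))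

lemma rhoG_meas : Measurable rhoG := by
  unfold rhoG; fun_prop

lemma gaussMap_meas : Measurable gaussMap := by
  unfold gaussMap
  exact measurable_fract.comp (by fun_prop)

lemma tele (y : ℝ) (hy : 0 ≤ y) :
    ∑' k : ℕ, ENNReal.ofReal (1 / ((k + 1 + y) * (k + 2 + y))) = rhoG y := by
  have h : HasSum (fun k : ℕ => 1 / ((k + 1 + y) * (k + 2 + y))) (1 / (1 + y)) := by
    rw [hasSum_iff_tendsto_nat_of_nonneg (fun k => by positivity)]
    have e : ∀ n : ℕ, ∑ k ∈ Finset.range n, 1 / (((k:ℝ) + 1 + y) * (k + 2 + y))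
        = 1 / (1 + y) - 1 / ((n : ℝ) + (1 + y)) := by
      intro n
      induction n with
      | zero => simp
      | succ n ih =>
        rw [Finset.sum_range_succ, ih]
        push_cast
        have : (n : ℝ) + 1 + y ≠ 0 := by positivity
        have : (n : ℝ) + 2 + y ≠ 0 := by positivity
        have : (n : ℝ) + (1 + y) ≠ 0 := by positivity
        have : (n : ℝ) + 1 + (1 + y) ≠ 0 := by positivity
        have : 1 + y ≠ 0 := by positivity
        field_simp
        ring
    simp_rw [e]
    have : Tendsto (fun n : ℕ => 1 / ((n : ℝ) + (1 + y))) atTop (nhds 0) := by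
      simp_rw [one_div]
      exact tendsto_inv_atTop_zero.comp
        (tendsto_atTop_add_const_right _ _ tendsto_natCast_atTop_atTop)
    simpa using tendsto_const_nhds.sub this
  rw [rhoG, ← h.tsum_eq, ENNReal.ofReal_tsum_of_nonneg (fun k => by positivity) h.summable]

lemma cover : Ioo (0:ℝ) 1 ⊆ ⋃ k : ℕ, Set.image (fun y : ℝ => 1 / ((k:ℝ) + 1 + y)) (Ico 0 1) := by
  intro x hx
  have hx0 := hx.1
  have h1 : 1 ≤ ⌊1 / x⌋₊ := by
    apply Nat.le_floor
    rw [Nat.cast_one, le_div_iff₀ hx0]; linarith [hx.2]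
  obtain ⟨k, hk⟩ := Nat.exists_eq_add_of_le' h1
  have h2 := Nat.floor_le (show 0 ≤ 1 / x by positivity)
  have h3 := Nat.lt_floor_add_one (1 / x)
  rw [hk] at h2 h3
  push_cast at h2 h3
  refine mem_iUnion.2 ⟨k, 1 / x - (k + 1), ⟨by linarith, by linarith⟩, ?_⟩
  simp

lemma gauss_inv (f : ℝ → ENNReal) (hf : Measurable f) :
    ∫⁻ x in Ioo (0:ℝ) 1, f (gaussMap x) * rhoG x ≤ ∫⁻ x in Ioo (0:ℝ) 1, f x * rhoG x := by
  have hk : ∀ k : ℕ, ∫⁻ x in Set.image (fun y : ℝ => 1 / ((k:ℝ) + 1 + y)) (Ico 0 1),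
      f (gaussMap x) * rhoG x
      = ∫⁻ y in Ico (0:ℝ) 1, f y * ENNReal.ofReal (1 / ((k + 1 + y) * (k + 2 + y))) := by
    intro k
    rw [lintegral_image_eq_lintegral_abs_deriv_mul (f' := fun y => -1 / ((k:ℝ) + 1 + y) ^ 2)
      measurableSet_Ico]
    · apply setLIntegral_congr_fun measurableSet_Ico
      intro y hy
      have hy0 : 0 ≤ y := hy.1
      have hg : gaussMap (1 / ((k:ℝ) + 1 + y)) = y := by
        unfold gaussMap
        rw [one_div_one_div, Int.fract_eq_iff]
        exact ⟨hy.1, hy.2, k + 1, by push_cast; ring⟩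
      simp only
      rw [hg, rhoG, mul_left_comm, ← ENNReal.ofReal_mul (abs_nonneg _)]
      congr 2
      have : (k : ℝ) + 1 + y ≠ 0 := by positivity
      have h2 : (k : ℝ) + 2 + y ≠ 0 := by positivity
      have h3 : (k : ℝ) + 1 + y + 1 ≠ 0 := by positivity
      rw [neg_div, abs_neg, abs_of_nonneg (by positivity)]
      field_simp
      ring
    · intro y hy
      have hy0 : 0 ≤ y := hy.1
      have h0 : (k : ℝ) + 1 + y ≠ 0 := by positivity
      have := ((hasDerivAt_id y).const_add ((k:ℝ) + 1)).inv h0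
      simp only [one_div]
      exact this.hasDerivWithinAt
    · intro a ha b hb hab
      simp only [one_div, inv_inj] at hab
      linarith
  calc ∫⁻ x in Ioo (0:ℝ) 1, f (gaussMap x) * rhoG x
      ≤ ∫⁻ x in ⋃ k : ℕ, Set.image (fun y : ℝ => 1 / ((k:ℝ) + 1 + y)) (Ico 0 1),
          f (gaussMap x) * rhoG x := lintegral_mono_set cover
    _ ≤ ∑' k : ℕ, ∫⁻ x in Set.image (fun y : ℝ => 1 / ((k:ℝ) + 1 + y)) (Ico 0 1),
          f (gaussMap x) * rhoG x := lintegral_iUnion_le _ _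
    _ = ∑' k : ℕ, ∫⁻ y in Ico (0:ℝ) 1,
          f y * ENNReal.ofReal (1 / ((k + 1 + y) * (k + 2 + y))) := by simp_rw [hk]
    _ = ∫⁻ y in Ico (0:ℝ) 1, ∑' k : ℕ,
          f y * ENNReal.ofReal (1 / ((k + 1 + y) * (k + 2 + y))) := by
        rw [lintegral_tsum]
        intro k
        exact (hf.mul (by fun_prop)).aemeasurable
    _ = ∫⁻ y in Ico (0:ℝ) 1, f y * rhoG y := by
        apply setLIntegral_congr_fun measurableSet_Ico
        intro y hy
        simp only
        rw [ENNReal.tsum_mul_left, tele y hy.1]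
    _ = _ := setLIntegral_congr Ioo_ae_eq_Ico.symm

lemma gauss_inv_iter (n : ℕ) (f : ℝ → ENNReal) (hf : Measurable f) :
    ∫⁻ x in Ioo (0:ℝ) 1, f (gaussMap^[n] x) * rhoG x ≤ ∫⁻ x in Ioo (0:ℝ) 1, f x * rhoG x := by
  induction n with
  | zero => simp
  | succ n ih =>
    simp_rw [Function.iterate_succ_apply]
    exact (gauss_inv _ (hf.comp (gaussMap_meas.iterate n))).trans ih

lemma trunc_bound (w : ℝ) (hw : 1 ≤ w) :
    ∫⁻ x in Ioo (0:ℝ) 1, ENNReal.ofReal (min (1 / x / w) 1) * rhoG x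
      ≤ ENNReal.ofReal ((1 + Real.log w) / w) := by
  have hw0 : 0 < w := by linarith
  have hw1 : 1 / w ≤ 1 := by rw [div_le_one hw0]; exact hw
  have hlog := Real.log_nonneg hw
  calc _ ≤ ∫⁻ x in Ioo (0:ℝ) 1, ENNReal.ofReal (min (1 / x / w) 1) := by
        apply setLIntegral_mono' measurableSet_Ioo
        intro x hx
        have : rhoG x ≤ 1 := by
          rw [rhoG, ENNReal.ofReal_le_one, div_le_one (by linarith [hx.1])]
          linarith [hx.1]
        exact mul_le_of_le_one_right' this
    _ ≤ ∫⁻ x in Ioc (0:ℝ) (1 / w) ∪ Ioc (1 / w) 1, ENNReal.ofReal (min (1 / x / w) 1) := by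
        apply lintegral_mono_set
        rw [Ioc_union_Ioc_eq_Ioc (by positivity) hw1]
        exact Ioo_subset_Ioc_self
    _ ≤ (∫⁻ x in Ioc (0:ℝ) (1 / w), ENNReal.ofReal (min (1 / x / w) 1))
        + ∫⁻ x in Ioc (1 / w) 1, ENNReal.ofReal (min (1 / x / w) 1) := lintegral_union_le _ _ _
    _ ≤ (∫⁻ x in Ioc (0:ℝ) (1 / w), 1)
        + ∫⁻ x in Ioc (1 / w) 1, ENNReal.ofReal (1 / x / w) := by
        gcongr
        · rw [ENNReal.ofReal_le_one]; exact min_le_right _ _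
        · exact min_le_left _ _
    _ = ENNReal.ofReal (1 / w) + ENNReal.ofReal (Real.log w / w) := by
        congr 1
        · simp
        · have hi : IntervalIntegrable (fun x : ℝ => 1 / x / w) volume (1 / w) 1 := by
            apply ContinuousOn.intervalIntegrable
            rw [uIcc_of_le hw1]
            intro x hx
            have : x ≠ 0 := by
              have : 0 < 1 / w := by positivity
              linarith [hx.1]
            apply ContinuousAt.continuousWithinAt
            fun_prop (disch := assumption)
          rw [← ofReal_integral_eq_lintegral_ofReal]
          · rw [← intervalIntegral.integral_of_le hw1, intervalIntegral.integral_div,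
              integral_one_div_of_pos (by positivity) one_pos]
            simp
          · exact (intervalIntegrable_iff_integrableOn_Ioc_of_le hw1).1 hi
          · rw [EventuallyLE, ae_restrict_iff' measurableSet_Ioc]
            refine Eventually.of_forall fun x hx => ?_
            have : 0 < 1 / w := by positivity
            have : 0 < x := by linarith [hx.1]
            simp only [Pi.zero_apply]
            positivity
    _ = _ := by
        rw [← ENNReal.ofReal_add (by positivity) (by positivity), add_div]

/-- The weights. -/
noncomputable def wG (n : ℕ) : ℝ := n * (1 + Real.log n) ^ 3

lemma wG_one_le {n : ℕ} (hn : 1 ≤ n) : 1 ≤ wG n := by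
  have h1 : (1:ℝ) ≤ n := by exact_mod_cast hn
  have := Real.log_nonneg h1
  unfold wG
  have h2 : (1:ℝ) ≤ (1 + Real.log n) ^ 3 := one_le_pow₀ (by linarith)
  nlinarith

lemma wG_mono {m n : ℕ} (hm : 1 ≤ m) (hmn : m ≤ n) : wG m ≤ wG n := by
  have h1 : (1:ℝ) ≤ m := by exact_mod_cast hm
  have h2 : (m:ℝ) ≤ n := by exact_mod_cast hmn
  have h3 := Real.log_nonneg h1
  have h4 := Real.log_le_log (by linarith) h2
  unfold wG
  gcongr

lemma summable_logsq : Summable (fun n : ℕ => 1 / ((n:ℝ) * (1 + Real.log n) ^ 2)) := by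
  rw [← summable_condensed_iff_of_nonneg]
  · have : Summable (fun k : ℕ => 4 * (1 / ((k + 1 : ℕ) : ℝ) ^ 2)) :=
      ((summable_nat_add_iff 1).2 (Real.summable_one_div_nat_pow.2 one_lt_two)).mul_left 4
    refine Summable.of_nonneg_of_le (fun k => by positivity) (fun k => ?_) this
    push_cast
    rw [Real.log_pow]
    have hl : (1:ℝ)/2 ≤ Real.log 2 := by linarith [Real.log_two_gt_d9]
    have hk : (0:ℝ) ≤ k := by positivity
    have h1 : ((k:ℝ) + 1) / 2 ≤ 1 + k * Real.log 2 := by nlinarith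
    have h2 : (((k:ℝ) + 1) / 2) ^ 2 ≤ (1 + k * Real.log 2) ^ 2 := by gcongr
    have e1 : (2:ℝ) ^ k * (1 / (2 ^ k * (1 + k * Real.log 2) ^ 2))
      = 1 / (1 + k * Real.log 2) ^ 2 := by
      have : 0 < 1 + (k:ℝ) * Real.log 2 := by positivity
      field_simp
    have e2 : 4 * (1 / ((k:ℝ) + 1) ^ 2) = 1 / (((k:ℝ) + 1) / 2) ^ 2 := by
      field_simp
      norm_num
    rw [e1, e2]
    exact one_div_le_one_div_of_le (by positivity) h2
  · intro n
    positivity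
  · intro m n hm hmn
    have h1 : (1:ℝ) ≤ m := by exact_mod_cast hm
    have h2 : (m:ℝ) ≤ n := by exact_mod_cast hmn
    have h3 := Real.log_nonneg h1
    have h4 := Real.log_le_log (by linarith) h2
    apply one_div_le_one_div_of_le (by positivity)
    gcongr

lemma summable_w : Summable (fun i : ℕ => (1 + Real.log (wG (i + 1))) / wG (i + 1)) := by
  have h := ((summable_nat_add_iff 1).2 summable_logsq).mul_left 4
  refine Summable.of_nonneg_of_le (fun i => ?_) (fun i => ?_) h
  · have := wG_one_le (Nat.le_add_left 1 i)
    have := Real.log_nonneg this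
    positivity
  · have hn : (1:ℝ) ≤ (i + 1 : ℕ) := by exact_mod_cast Nat.le_add_left 1 i
    set x : ℝ := ((i + 1 : ℕ) : ℝ) with hx
    have h0 := Real.log_nonneg hn
    have e : Real.log (wG (i + 1)) = Real.log x + 3 * Real.log (1 + Real.log x) := by
      rw [wG, ← hx, Real.log_mul (by positivity) (by positivity), Real.log_pow]
      norm_num
    have hl : Real.log (1 + Real.log x) ≤ Real.log x := by
      have := Real.log_le_sub_one_of_pos (show 0 < 1 + Real.log x by positivity)
      linarith
    have e2 : 4 * (1 / (x * (1 + Real.log x) ^ 2)) = (4 * (1 + Real.log x)) / wG (i + 1) := by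
      rw [wG, ← hx]
      field_simp
    rw [e2, e]
    have := wG_one_le (Nat.le_add_left 1 i)
    gcongr
    linarith

lemma ae_fin : ∀ᵐ α ∂(volume.restrict (Set.Ioo (0:ℝ) 1)),
    ∑' i : ℕ, ENNReal.ofReal (min (1 / (gaussMap^[i] α) / wG (i + 1)) 1) ≠ ⊤ := by
  have hm : ∀ i : ℕ, Measurable fun x : ℝ => ENNReal.ofReal (min (1 / x / wG (i + 1)) 1) := by
    intro i; fun_prop
  have hm2 : ∀ i : ℕ, Measurable fun x : ℝ =>
      ENNReal.ofReal (min (1 / (gaussMap^[i] x) / wG (i + 1)) 1) * rhoG x := fun i =>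
    ((hm i).comp (gaussMap_meas.iterate i)).mul rhoG_meas
  have hfin : ∫⁻ x in Ioo (0:ℝ) 1, ∑' i : ℕ,
      ENNReal.ofReal (min (1 / (gaussMap^[i] x) / wG (i + 1)) 1) * rhoG x ≠ ⊤ := by
    rw [lintegral_tsum (fun i => (hm2 i).aemeasurable)]
    refine ne_top_of_le_ne_top summable_w.tsum_ofReal_ne_top (ENNReal.tsum_le_tsum fun i => ?_)
    exact (gauss_inv_iter i _ (hm i)).trans (trunc_bound _ (wG_one_le (Nat.le_add_left 1 i)))
  have h1 := ae_lt_top (Measurable.tsum hm2) hfin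
  filter_upwards [h1, ae_restrict_mem measurableSet_Ioo] with x hx hx2
  rw [ENNReal.tsum_mul_right] at hx
  intro htop
  rw [htop, ENNReal.top_mul] at hx
  · exact lt_irrefl _ hx
  · have : 0 < 1 + x := by linarith [hx2.1]
    rw [rhoG]
    exact (ENNReal.ofReal_pos.2 (by positivity)).ne'

lemma iter_nonneg (α : ℝ) (h : 0 < α) (i : ℕ) : 0 ≤ gaussMap^[i] α := by
  cases i with
  | zero => exact h.le
  | succ i => rw [Function.iterate_succ_apply']; exact Int.fract_nonneg _

theorem stmt12 :
    ∀ᵐ α ∂(volume.restrict (Set.Ioo (0:ℝ) 1)), Irrational α →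
      ∃ C₁ : ℝ, 0 < C₁ ∧ ∀ n : ℕ, 2 ≤ n →
        (∑ i ∈ Finset.Icc 1 n, (cfA α i : ℝ)) < C₁ * n * (Real.log n) ^ 3 := by
  filter_upwards [ae_fin, ae_restrict_mem measurableSet_Ioo] with α hα hmem _
  have hit := iter_nonneg α hmem.1
  have hw : ∀ i : ℕ, 1 ≤ wG (i + 1) := fun i => wG_one_le (Nat.le_add_left 1 i)
  have hw0 : ∀ i : ℕ, 0 < wG (i + 1) := fun i => by linarith [hw i]
  have hq : ∀ i, 0 ≤ 1 / (gaussMap^[i] α) / wG (i + 1) := fun i =>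
    div_nonneg (one_div_nonneg.2 (hit i)) (hw0 i).le
  have hs : Summable fun i : ℕ => min (1 / (gaussMap^[i] α) / wG (i + 1)) 1 := by
    have := ENNReal.summable_toReal hα
    refine this.congr fun i => ?_
    rw [ENNReal.toReal_ofReal (le_min (hq i) zero_le_one)]
  have hev : ∀ᶠ i in atTop, min (1 / (gaussMap^[i] α) / wG (i + 1)) 1 < 1 :=
    hs.tendsto_atTop_zero.eventually_lt_const one_pos
  have hs2 : Summable fun i : ℕ => 1 / (gaussMap^[i] α) / wG (i + 1) := by
    refine hs.congr_atTop ?_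
    filter_upwards [hev] with i hi
    rcases min_lt_iff.1 hi with h | h
    · exact min_eq_left h.le
    · exact absurd h (lt_irrefl _)
  set S := ∑' i : ℕ, 1 / (gaussMap^[i] α) / wG (i + 1) with hS
  have hS0 : 0 ≤ S := tsum_nonneg hq
  refine ⟨27 * (S + 1), by positivity, fun n hn => ?_⟩
  have hn0 : (2:ℝ) ≤ n := by exact_mod_cast hn
  have hwn : 1 ≤ wG n := wG_one_le (by omega)
  have hlog : 1 / 2 < Real.log n := by
    have := Real.log_le_log (by norm_num) hn0
    linarith [Real.log_two_gt_d9]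
  have h1 : ∑ i ∈ Finset.Icc 1 n, (cfA α i : ℝ) ≤ wG n * S := by
    calc ∑ i ∈ Finset.Icc 1 n, (cfA α i : ℝ)
        = ∑ i ∈ Finset.range n, (cfA α (i + 1) : ℝ) := by
          rw [Finset.range_eq_Ico, Finset.sum_Ico_add' (fun i => (cfA α i : ℝ)) 0 n 1]
          rfl
      _ ≤ ∑ i ∈ Finset.range n, wG n * (1 / (gaussMap^[i] α) / wG (i + 1)) := by
          refine Finset.sum_le_sum fun i hi => ?_
          have hin : i + 1 ≤ n := Finset.mem_range.1 hi
          have h2 : (cfA α (i + 1) : ℝ) ≤ 1 / (gaussMap^[i] α) :=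
            Nat.floor_le (one_div_nonneg.2 (hit i))
          have h3 := mul_le_mul_of_nonneg_right (wG_mono (Nat.le_add_left 1 i) hin) (hq i)
          rw [mul_div_cancel₀ _ (hw0 i).ne'] at h3
          exact h2.trans h3
      _ = wG n * ∑ i ∈ Finset.range n, (1 / (gaussMap^[i] α) / wG (i + 1)) := by
          rw [Finset.mul_sum]
      _ ≤ wG n * S := by
          gcongr
          exact hs2.sum_le_tsum _ (fun i _ => hq i)
  have h2 : wG n ≤ n * (3 * Real.log n) ^ 3 := by
    unfold wG
    gcongr
    linarith
  calc _ ≤ wG n * S := h1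
    _ < wG n * (S + 1) := by nlinarith
    _ ≤ (n * (3 * Real.log n) ^ 3) * (S + 1) := by gcongr
    _ = _ := by ring
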